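/- Let 1 ≤ d < N be integers, s ∈ [0,∞), A ∈ ℝ^{d×(N−d)}, α₀ ∈ ℝ^{N−d}, and let Ã ∈ ℝ^{(d+1)×(N−d)} be the matrix with first row α₀ and remaining rows those of A. Assume Ã is φ̃-semi multiplicatively badly approximable, where φ̃ : [1,∞) → (0,1] is non-increasing and satisfies: (i) for every λ ≥ 1 there is c_λ > 0 with φ̃(λx) ≥ c_λ φ̃(x) for all x ≥ 1; (ii) there exist γ > 0 and c₁, c₂ > 0 with c₁ x^{−γ} ≤ φ̃(x) for all x ≥ 1 and φ̃(x) ≤ c₂/log(x) for all x > 1; (iii) there exists a non-increasing ψ̂ : [1,∞) → (0,1] with Σ_{q=1}^∞ ψ̂(q)^{N−d+s} q^{d−s} < ∞ and a constant c₃ > 0 such that φ̃(1/ψ̂(x)) · ψ̂(x)^{N−d} ≥ c₃ (log x)^d / x^{d+1} for all x ≥ 2. Then for every non-increasing ψ : [1,∞) → (0,1] with Σ_{q=1}^∞ ψ(q)^{N−d+s} q^{d−s} < ∞, the s-dimensional Hausdorff measure of 𝒮_N(ψ) ∩ ℋ is 0, where ℋ := {(x, x̃Ã) : x ∈ [0,1]^d}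 ⊂ ℝ^N. -/

import Mathlib

open scoped BigOperators

/-- distance from a real number to the nearest integer -/
noncomputable def distNearestInt (x : ℝ) : ℝ := |x - (round x : ℤ)|

/-- the sup norm `|q|_∞` of an integer vector, as a real number -/
noncomputable def intSupNorm {k : ℕ} (q : Fin k → ℤ) : ℝ := ‖(fun j => (q j : ℝ))‖

/-- the set `𝒮_N(ψ)` of simultaneously `ψ`-approximable points in `ℝ^N` -/
def simultApprox (N : ℕ) (ψ : ℝ → ℝ) : Set (EuclideanSpace ℝ (Fin N)) :=
  {z | {q : ℕ | 0 < q ∧ ∀ i, distNearestInt ((q : ℝ) * z i) < ψ q}.Infinite}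

section

open MeasureTheory

/-- The Haar probability measure on the torus `(ℝ/ℤ)^ι`. -/
noncomputable abbrev torusMeasure (ι : Type*) [Fintype ι] : Measure (UnitAddTorus ι) :=
  Measure.pi fun _ => AddCircle.haarAddCircle

/-- A consequence of the Bessel inequality: few characters have large real part on a given set. -/
theorem card_mul_torusMeasure_le {ι : Type*} [Fintype ι] {U : Set (UnitAddTorus ι)}
    (hU : MeasurableSet U) (V : Finset (ι → ℤ))
    (h : ∀ v ∈ V, ∀ t ∈ U, 1 / 2 ≤ (UnitAddTorus.mFourier v t).re) :
    (V.card : ℝ) * (torusMeasure ι).real U ≤ 4 := by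
  set μ := torusMeasure ι
  have horth : Orthonormal ℂ (fun v : ι → ℤ =>
      ContinuousMap.toLp (E := ℂ) 2 μ ℂ (UnitAddTorus.mFourier v)) :=
    UnitAddTorus.orthonormal_mFourier (d := ι)
  have hUfin : μ U ≠ ⊤ := measure_ne_top _ _
  have hbessel := horth.sum_inner_products_le (s := V) (indicatorConstLp 2 hU hUfin (1 : ℂ))
  have hnorm : ‖indicatorConstLp 2 hU hUfin (1 : ℂ)‖ ^ 2 = μ.real U := by
    rw [norm_indicatorConstLp (by norm_num) (by norm_num)]
    rw [norm_one, one_mul, ← Real.rpow_natCast, ← Real.rpow_mul measureReal_nonneg]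
    norm_num
  have hcoef : ∀ v ∈ V, (μ.real U / 2) ^ 2 ≤
      ‖inner ℂ (ContinuousMap.toLp (E := ℂ) 2 μ ℂ (UnitAddTorus.mFourier v))
        (indicatorConstLp 2 hU hUfin (1 : ℂ))‖ ^ 2 := by
    intro v hv
    refine pow_le_pow_left₀ (by positivity) ?_ 2
    rw [norm_inner_symm, L2.inner_indicatorConstLp_one]
    have hcongr : ∫ x in U, (ContinuousMap.toLp (E := ℂ) 2 μ ℂ (UnitAddTorus.mFourier v)) x ∂μ
        = ∫ x in U, UnitAddTorus.mFourier v x ∂μ := by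
      refine integral_congr_ae (ae_restrict_of_ae ?_)
      exact ContinuousMap.coeFn_toLp μ (UnitAddTorus.mFourier v)
    rw [hcongr]
    refine le_trans ?_ (Complex.re_le_norm _)
    have hint : Integrable (fun x => UnitAddTorus.mFourier v x) (μ.restrict U) :=
      ((UnitAddTorus.mFourier v).continuous.integrable_of_hasCompactSupport
        (HasCompactSupport.of_compactSpace _)).restrict
    have hre := integral_re hint
    simp only [RCLike.re_eq_complex_re] at hre
    rw [← hre]
    calc μ.real U / 2 = ∫ x in U, (1 / 2 : ℝ) ∂μ := by
          rw [setIntegral_const, smul_eq_mul]; ring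
      _ ≤ _ := setIntegral_mono_on (integrable_const _) hint.re hU (h v hv)
  rw [hnorm] at hbessel
  have hsum := (Finset.card_nsmul_le_sum V _ _ hcoef).trans hbessel
  rw [nsmul_eq_mul] at hsum
  rcases (measureReal_nonneg (μ := μ) (s := U)).eq_or_lt with h0 | h0
  · rw [← h0]; norm_num
  · nlinarith

theorem half_le_re_toCircle {y : UnitAddCircle} (hy : ‖y‖ ≤ 1 / 6) :
    1 / 2 ≤ (AddCircle.toCircle y : ℂ).re := by
  induction y using QuotientAddGroup.induction_on with
  | H x =>
    have hx : (x : UnitAddCircle) = ((x - round x : ℝ) : UnitAddCircle) := by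
      rw [AddCircle.coe_sub, eq_comm, sub_eq_self, AddCircle.coe_eq_zero_iff]
      exact ⟨round x, by simp⟩
    have hn : |x - round x| ≤ 1 / 6 := by rwa [← UnitAddCircle.norm_eq]
    change 1 / 2 ≤ ((AddCircle.toCircle (x : UnitAddCircle) : Circle) : ℂ).re
    rw [hx, AddCircle.toCircle_apply_mk, Circle.coe_exp, Complex.exp_ofReal_mul_I_re,
      ← Real.cos_abs, ← Real.cos_pi_div_three]
    have hpi := Real.pi_pos
    apply Real.cos_le_cos_of_nonneg_of_le_pi (abs_nonneg _) (by linarith)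
    rw [abs_mul, div_one, abs_of_pos (by positivity)]
    nlinarith

theorem mFourier_eq_toCircle {ι : Type*} [Fintype ι] (v : ι → ℤ) (t : UnitAddTorus ι) :
    UnitAddTorus.mFourier v t = (AddCircle.toCircle (∑ i, v i • t i) : ℂ) := by
  have hsum : ∀ S : Finset ι, ((AddCircle.toCircle (∑ i ∈ S, v i • t i) : Circle) : ℂ) =
      ∏ i ∈ S, fourier (v i) (t i) := by
    classical
    intro S
    induction S using Finset.induction_on with
    | empty => simp
    | insert i S hi ih =>
      rw [Finset.sum_insert hi, Finset.prod_insert hi, AddCircle.toCircle_add, Circle.coe_mul, ih,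
        fourier_apply]
  exact (hsum Finset.univ).symm

theorem torusMeasure_closedBall {ι : Type*} [Fintype ι] (c : UnitAddTorus ι) {r : ℝ}
    (hr : 0 ≤ r) (hr' : 2 * r ≤ 1) :
    (torusMeasure ι).real (Metric.closedBall c r) = (2 * r) ^ Fintype.card ι := by
  have hcirc : ∀ y : UnitAddCircle,
      AddCircle.haarAddCircle (Metric.closedBall y r) = ENNReal.ofReal (2 * r) := by
    intro y
    have := AddCircle.volume_closedBall (T := 1) (x := y) r
    rw [min_eq_right hr', AddCircle.volume_eq_smul_haarAddCircle] at this
    simpa using this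
  rw [measureReal_def, Measure.pi_closedBall _ _ hr]
  simp [hcirc, hr]

/-- A large sieve bound: integer vectors `V` whose pairing with all `θ k`, `k ∈ K`, is almost
integral are few if the points `θ k` of the torus are well separated. -/
theorem card_mul_card_mul_le {ι κ : Type*} [Fintype ι] [Fintype κ]
    (θ : ι → κ → UnitAddCircle) (V : Finset (ι → ℤ)) (K : Finset (κ → ℤ)) {r : ℝ}
    (hr : 0 ≤ r) (hr' : 2 * r ≤ 1)
    (hVK : ∀ v ∈ V, ∀ k ∈ K, ‖∑ i, v i • ∑ j, k j • θ i j‖ ≤ 1 / 12)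
    (hV : ∀ v ∈ V, ∑ i, |(v i : ℝ)| * r ≤ 1 / 12)
    (hK : ∀ k ∈ K, ∀ k' ∈ K, k ≠ k' → ∃ i, 2 * r < ‖∑ j, (k j - k' j) • θ i j‖) :
    (V.card : ℝ) * (K.card * (2 * r) ^ Fintype.card ι) ≤ 4 := by
  let c : (κ → ℤ) → UnitAddTorus ι := fun k i => ∑ j, k j • θ i j
  have hmeas : ∀ k ∈ K, MeasurableSet (Metric.closedBall (c k) r) :=
    fun k _ => Metric.isClosed_closedBall.measurableSet
  have hdisj : (K : Set (κ → ℤ)).PairwiseDisjoint fun k => Metric.closedBall (c k) r := by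
    intro k hk k' hk' hne
    obtain ⟨i, hi⟩ := hK k hk k' hk' hne
    refine Metric.closedBall_disjoint_closedBall ?_
    refine lt_of_lt_of_le ?_ (dist_le_pi_dist (c k) (c k') i)
    rw [dist_eq_norm, ← Finset.sum_sub_distrib]
    refine lt_of_eq_of_lt (two_mul r).symm (hi.trans_eq ?_)
    exact congrArg _ (Finset.sum_congr rfl fun j _ => sub_smul _ _ _)
  have hvol : (torusMeasure ι).real (⋃ k ∈ K, Metric.closedBall (c k) r) =
      K.card * (2 * r) ^ Fintype.card ι := by
    rw [measureReal_biUnion_finset hdisj hmeas]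
    simp [torusMeasure_closedBall _ hr hr']
  rw [← hvol]
  refine card_mul_torusMeasure_le (Finset.measurableSet_biUnion _ hmeas) V ?_
  intro v hv t ht
  simp only [Set.mem_iUnion] at ht
  obtain ⟨k, hk, ht⟩ := ht
  rw [mFourier_eq_toCircle]
  refine half_le_re_toCircle ?_
  have hsplit : ∑ i, v i • t i = ∑ i, v i • c k i + ∑ i, v i • (t i - c k i) := by
    rw [← Finset.sum_add_distrib]
    exact Finset.sum_congr rfl fun i _ => by rw [← zsmul_add, add_sub_cancel]
  have hsmall : ‖∑ i, v i • (t i - c k i)‖ ≤ 1 / 12 := by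
    refine (norm_sum_le _ _).trans (le_trans (Finset.sum_le_sum fun i _ => ?_) (hV v hv))
    refine (norm_zsmul_le _ _).trans ?_
    rw [Int.norm_eq_abs]
    refine mul_le_mul_of_nonneg_left ?_ (abs_nonneg _)
    rw [← dist_eq_norm]
    exact (dist_le_pi_dist t (c k) i).trans ht
  rw [hsplit]
  refine (norm_add_le _ _).trans ?_
  have := hVK v hv k hk
  simp only [c] at hsmall ⊢
  linarith

theorem distNearestInt_eq_norm (x : ℝ) : distNearestInt x = ‖(x : UnitAddCircle)‖ :=
  UnitAddCircle.norm_eq.symm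

theorem distNearestInt_le_abs (x : ℝ) : distNearestInt x ≤ |x| := by
  simpa [distNearestInt] using round_le x 0

theorem distNearestInt_add_le (x y : ℝ) :
    distNearestInt (x + y) ≤ distNearestInt x + distNearestInt y := by
  simp only [distNearestInt_eq_norm, AddCircle.coe_add]
  exact norm_add_le _ _

theorem sum_zsmul_coe {κ : Type*} [Fintype κ] (k : κ → ℤ) (a : κ → ℝ) :
    ∑ j, k j • (a j : UnitAddCircle) = ((∑ j, a j * k j : ℝ) : UnitAddCircle) := by
  have h := map_sum (QuotientAddGroup.mk' (AddSubgroup.zmultiples (1 : ℝ)))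
    (fun j => a j * (k j : ℝ)) Finset.univ
  refine Eq.trans (Finset.sum_congr rfl fun j _ => ?_) h.symm
  rw [mul_comm, ← zsmul_eq_mul]
  rfl

theorem one_le_intSupNorm {k : ℕ} {q : Fin k → ℤ} (hq : q ≠ 0) : 1 ≤ intSupNorm q := by
  obtain ⟨j, hj⟩ := Function.ne_iff.mp hq
  refine le_trans ?_ (norm_le_pi_norm (fun j => (q j : ℝ)) j)
  rw [Real.norm_eq_abs]
  exact_mod_cast Int.one_le_abs hj

/-- Upper bound for the number of integer points of a box whose image under `Atil` is close to
an integer point. -/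
theorem card_le_of_semi_mult_bad {d m : ℕ} (hm : 0 < m)
    (Atil : Matrix (Fin (d + 1)) (Fin m) ℝ) {φ : ℝ → ℝ}
    (hφmono : ∀ x y, 1 ≤ x → x ≤ y → φ y ≤ φ x)
    (hbad : ∀ q : Fin m → ℤ, q ≠ 0 →
      φ (intSupNorm q) ≤ intSupNorm q ^ m *
        ∏ i, distNearestInt (∑ j, Atil i j * (q j : ℝ)))
    {M δ R : ℝ} (hM : 1 ≤ M) (hδ : 0 < δ) (hR : 1 ≤ R)
    (hlarge : (1 / (6 * (d + 1) * R)) ^ (d + 1) < φ (1 / δ) * δ ^ m)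
    (V : Finset (Fin (d + 1) → ℤ)) (hVR : ∀ v ∈ V, ∀ i, |(v i : ℝ)| ≤ R)
    (hV : ∀ v ∈ V, ∀ j, distNearestInt (∑ i, Atil i j * (v i : ℝ)) ≤ M * δ) :
    (V.card : ℝ) ≤ 4 * (12 * m * M * δ) ^ m * (6 * (d + 1) * R) ^ (d + 1) := by
  have hm1 : (1 : ℝ) ≤ m := by exact_mod_cast hm
  have hM0 : 0 < M := by linarith
  have hR0 : 0 < R := by linarith
  set D : ℝ := 12 * m * M * δ with hD
  have hD0 : 0 < D := by positivity
  set T : ℕ := ⌊1 / D⌋₊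
  have hTle : (T : ℝ) ≤ 1 / D := Nat.floor_le (by positivity)
  have hTlt : 1 / D < T + 1 := Nat.lt_floor_add_one _
  set r : ℝ := 1 / (12 * (d + 1) * R) with hr
  have h2r : 2 * r = 1 / (6 * (d + 1) * R) := by rw [hr]; field_simp; norm_num
  have hr0 : 0 < r := by positivity
  have hr1 : 2 * r ≤ 1 := by
    rw [h2r, div_le_one (by positivity)]
    have : (0 : ℝ) ≤ d := Nat.cast_nonneg d
    nlinarith
  set K : Finset (Fin m → ℤ) := Fintype.piFinset fun _ => Finset.Icc (0 : ℤ) T with hKdef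
  have hKmem : ∀ k ∈ K, ∀ j, 0 ≤ k j ∧ k j ≤ T := by
    intro k hk j
    simpa using (Fintype.mem_piFinset.mp hk) j
  have hKcard : (K.card : ℝ) = (T + 1) ^ m := by
    rw [hKdef, Fintype.card_piFinset]
    simp
  have hmain := card_mul_card_mul_le (fun i j => (Atil i j : UnitAddCircle)) V K hr0.le hr1 ?_ ?_ ?_
  · rw [hKcard, h2r, Fintype.card_fin] at hmain
    have hpow : (1 / D) ^ m ≤ ((T : ℝ) + 1) ^ m := pow_le_pow_left₀ (by positivity) hTlt.le m
    have hle : (V.card : ℝ) * ((1 / D) ^ m * (1 / (6 * (d + 1) * R)) ^ (d + 1)) ≤ 4 :=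
      le_trans (by gcongr) hmain
    rw [one_div_pow, one_div_pow] at hle
    have hP : 0 < D ^ m := by positivity
    have hP' : 0 < (6 * ((d : ℝ) + 1) * R) ^ (d + 1) := by positivity
    field_simp at hle
    linarith
  · intro v hv k hk
    have hswap : ∑ i, v i • ∑ j, k j • (Atil i j : UnitAddCircle) =
        ∑ j, k j • ∑ i, v i • (Atil i j : UnitAddCircle) := by
      simp only [Finset.smul_sum]
      rw [Finset.sum_comm]
      exact Finset.sum_congr rfl fun j _ => Finset.sum_congr rfl fun i _ => smul_comm _ _ _
    rw [hswap]
    have hterm : ∀ j ∈ Finset.univ, ‖k j • ∑ i, v i • (Atil i j : UnitAddCircle)‖ ≤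
        1 / D * (M * δ) := by
      intro j _
      refine (norm_zsmul_le _ _).trans ?_
      rw [sum_zsmul_coe, ← distNearestInt_eq_norm, Int.norm_eq_abs]
      refine mul_le_mul ?_ (hV v hv j) (abs_nonneg _) (by positivity)
      have := hKmem k hk j
      rw [abs_of_nonneg (by exact_mod_cast this.1)]
      exact le_trans (by exact_mod_cast this.2) hTle
    refine (norm_sum_le_of_le _ hterm).trans ?_
    rw [Finset.sum_const, Finset.card_univ, Fintype.card_fin, nsmul_eq_mul, hD]
    apply le_of_eq
    field_simp
  · intro v hv
    calc ∑ i, |(v i : ℝ)| * r ≤ ∑ _i : Fin (d + 1), R * r := by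
          gcongr with i
          exact hVR v hv i
      _ = 1 / 12 := by
          rw [Finset.sum_const, Finset.card_univ, Fintype.card_fin, nsmul_eq_mul, hr]
          push_cast
          field_simp
  · intro k hk k' hk' hne
    by_contra! hcon
    set q : Fin m → ℤ := k - k' with hq
    have hq0 : q ≠ 0 := sub_ne_zero.mpr hne
    have h1 := one_le_intSupNorm hq0
    have hdist : ∀ i, distNearestInt (∑ j, Atil i j * (q j : ℝ)) ≤ 2 * r := by
      intro i
      rw [distNearestInt_eq_norm, ← sum_zsmul_coe]
      exact hcon i
    have hqT : intSupNorm q ≤ 1 / δ := by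
      refine (pi_norm_le_iff_of_nonneg (by positivity)).mpr fun j => ?_
      have hk1 := hKmem k hk j
      have hk2 := hKmem k' hk' j
      have habs : |q j| ≤ (T : ℤ) := by
        rw [abs_le]
        simp only [hq, Pi.sub_apply]
        omega
      have habs' : |(q j : ℝ)| ≤ T := by exact_mod_cast habs
      refine le_trans habs' (hTle.trans ?_)
      apply one_div_le_one_div_of_le hδ
      rw [hD]
      have : (1 : ℝ) ≤ m * M := by nlinarith
      nlinarith
    have hprod : ∏ i, distNearestInt (∑ j, Atil i j * (q j : ℝ)) ≤ (2 * r) ^ (d + 1) := by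
      refine (Finset.prod_le_prod (fun i _ => abs_nonneg _) fun i _ => hdist i).trans ?_
      simp
    have hφ : φ (1 / δ) ≤ (1 / δ) ^ m * (2 * r) ^ (d + 1) :=
      (hφmono _ _ h1 hqT).trans <| (hbad q hq0).trans <| by
        refine mul_le_mul (pow_le_pow_left₀ (by linarith) hqT m) hprod
          (Finset.prod_nonneg fun i _ => abs_nonneg _) (by positivity)
    rw [← h2r] at hlarge
    have hδm : 0 < δ ^ m := by positivity
    have : φ (1 / δ) * δ ^ m ≤ (2 * r) ^ (d + 1) := by
      calc φ (1 / δ) * δ ^ m ≤ (1 / δ) ^ m * (2 * r) ^ (d + 1) * δ ^ m := by gcongr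
        _ = (2 * r) ^ (d + 1) := by
          rw [one_div_pow]; field_simp
    linarith

/-- Cauchy condensation for a non-increasing function against a power weight. -/
theorem summable_condensed_mul_rpow {ψ : ℝ → ℝ} {e a : ℝ} (he : 0 ≤ e)
    (hpos : ∀ x, 1 ≤ x → 0 < ψ x) (hmono : ∀ x y, 1 ≤ x → x ≤ y → ψ y ≤ ψ x)
    (hsum : Summable fun q : ℕ => ψ ((q : ℝ) + 1) ^ e * ((q : ℝ) + 1) ^ a) :
    Summable fun n : ℕ => ψ (2 ^ n) ^ e * ((2 : ℝ) ^ n) ^ (a + 1) := by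
  set F : ℕ → ℝ := fun q => ψ q ^ e * (q : ℝ) ^ a with hF
  set g : ℕ → ℝ := fun n => ψ (2 ^ n) ^ e * ((2 : ℝ) ^ n) ^ (a + 1) with hg
  have hg0 : ∀ n, 0 ≤ g n := fun n =>
    mul_nonneg (Real.rpow_nonneg (hpos _ (one_le_pow₀ one_le_two)).le _) (by positivity)
  have hblock : ∀ n, g (n + 1) ≤ 2 * 2 ^ |a| * ∑ q ∈ Finset.Ico (2 ^ n) (2 ^ (n + 1)), F q := by
    intro n
    set P : ℝ := 2 ^ (n + 1) with hP
    have hP0 : 0 < P := by positivity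
    have hψ0 : 0 ≤ ψ P ^ e := Real.rpow_nonneg (hpos _ (one_le_pow₀ one_le_two)).le _
    have hterm : ∀ q ∈ Finset.Ico (2 ^ n) (2 ^ (n + 1)),
        ψ P ^ e * (P ^ a * (2 ^ |a|)⁻¹) ≤ F q := by
      intro q hq
      rw [Finset.mem_Ico] at hq
      have hq1 : (2 : ℝ) ^ n ≤ q := by exact_mod_cast hq.1
      have hq2 : (q : ℝ) ≤ P := by rw [hP]; exact_mod_cast hq.2.le
      have hqone : (1 : ℝ) ≤ q := (one_le_pow₀ one_le_two).trans hq1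
      have hq0 : (0 : ℝ) < q := by linarith
      have hPq : P ≤ 2 * q := by rw [hP, pow_succ]; linarith
      refine mul_le_mul ?_ ?_ (by positivity) (Real.rpow_nonneg (hpos _ hqone).le _)
      · exact Real.rpow_le_rpow (hpos _ (hqone.trans hq2)).le (hmono _ _ hqone hq2) he
      · rw [← div_eq_mul_inv, div_le_iff₀ (by positivity), mul_comm, ← div_le_iff₀ (by positivity),
          ← Real.div_rpow hP0.le hq0.le]
        have hy1 : 1 ≤ P / q := (one_le_div hq0).mpr hq2
        have hy2 : P / q ≤ 2 := (div_le_iff₀ hq0).mpr hPq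
        calc (P / q) ^ a ≤ (P / q) ^ |a| := Real.rpow_le_rpow_of_exponent_le hy1 (le_abs_self a)
          _ ≤ 2 ^ |a| := Real.rpow_le_rpow (by linarith) hy2 (abs_nonneg a)
    have hsumle := Finset.card_nsmul_le_sum _ _ _ hterm
    rw [Nat.card_Ico, pow_succ, mul_two, Nat.add_sub_cancel, nsmul_eq_mul, ← mul_two,
      ← pow_succ] at hsumle
    push_cast at hsumle
    calc g (n + 1) = 2 * 2 ^ |a| * (2 ^ n * (ψ P ^ e * (P ^ a * (2 ^ |a|)⁻¹))) := by
          simp only [hg]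
          rw [← hP, Real.rpow_add_one hP0.ne', show P = 2 ^ n * 2 by rw [hP, pow_succ]]
          field_simp
      _ ≤ _ := by gcongr
  have hFshift : Summable fun q : ℕ => F (1 + q) := by
    refine hsum.congr fun q => ?_
    simp only [hF]
    push_cast
    rw [add_comm]
  rw [← summable_nat_add_iff 1]
  refine summable_of_sum_range_le (c := 2 * 2 ^ |a| * ∑' q, F (1 + q)) (fun n => hg0 _) fun L => ?_
  refine (Finset.sum_le_sum fun n _ => hblock n).trans ?_
  rw [← Finset.mul_sum]
  refine mul_le_mul_of_nonneg_left ?_ (by positivity)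
  have hunion : ∑ n ∈ Finset.range L, ∑ q ∈ Finset.Ico (2 ^ n) (2 ^ (n + 1)), F q =
      ∑ q ∈ Finset.Ico 1 (2 ^ L), F q := by
    induction L with
    | zero => simp
    | succ L ih =>
      rw [Finset.sum_range_succ, ih]
      exact Finset.sum_Ico_consecutive _ Nat.one_le_two_pow
        (Nat.pow_le_pow_right two_pos (Nat.le_succ L))
  rw [hunion, Finset.sum_Ico_eq_sum_range]
  refine hFshift.sum_le_tsum _ fun q _ => ?_
  have : (1 : ℝ) ≤ ((1 + q : ℕ) : ℝ) := by push_cast; linarith [(Nat.cast_nonneg q : (0 : ℝ) ≤ q)]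
  exact mul_nonneg (Real.rpow_nonneg (hpos _ this).le _) (by positivity)

open Filter Topology ENNReal in
/-- The Hausdorff–Cantelli lemma. -/
theorem hausdorffMeasure_eq_zero_of_covers {X ι : Type*} [EMetricSpace X] [MeasurableSpace X]
    [BorelSpace X] {s : ℝ} (hs : 0 ≤ s) {E : Set X} (V : ℕ → Finset ι) (S : ℕ → ι → Set X)
    {ρ b : ℕ → ℝ≥0∞} (hρanti : Antitone ρ) (hρ : Tendsto ρ atTop (𝓝 0))
    (hdiam : ∀ n, ∀ v ∈ V n, Metric.ediam (S n v) ≤ ρ n)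
    (hb : ∑' n, b n ≠ ⊤) (hVb : ∀ᶠ n in atTop, (V n).card * ρ n ^ s ≤ b n)
    (hcov : ∀ n₀, E ⊆ ⋃ n ≥ n₀, ⋃ v ∈ V n, S n v) :
    μH[s] E = 0 := by
  let t : ∀ n₀ : ℕ, (Σ n : ℕ, V (n + n₀)) → Set X := fun n₀ i => S (i.1 + n₀) i.2
  have hcount : ∀ n₀ : ℕ, Countable (Σ n : ℕ, V (n + n₀)) := fun n₀ => inferInstance
  have hle := Measure.hausdorffMeasure_le_liminf_tsum (l := atTop) s E ρ hρ t
    (Eventually.of_forall fun n₀ i =>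
      (hdiam _ _ i.2.2).trans (hρanti (Nat.le_add_left n₀ i.1)))
    (Eventually.of_forall fun n₀ => by
      intro x hx
      obtain ⟨n, hn, v, hv, hxv⟩ := by simpa only [Set.mem_iUnion] using hcov n₀ hx
      obtain ⟨k, rfl⟩ := Nat.exists_eq_add_of_le' hn
      exact Set.mem_iUnion.mpr ⟨⟨k, ⟨v, hv⟩⟩, hxv⟩)
  refine le_antisymm (hle.trans ?_) bot_le
  have htail := ENNReal.tendsto_sum_nat_add b hb
  rw [← htail.liminf_eq]
  refine liminf_le_liminf ?_
  obtain ⟨n₁, hn₁⟩ := eventually_atTop.mp hVb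
  filter_upwards [eventually_ge_atTop n₁] with n₀ hn₀
  rw [ENNReal.tsum_sigma']
  refine ENNReal.tsum_le_tsum fun n => le_trans ?_ (hn₁ (n + n₀) (by omega))
  rw [tsum_fintype]
  refine (Finset.sum_le_card_nsmul _ _ (ρ (n + n₀) ^ s) fun v _ =>
    ENNReal.rpow_le_rpow (hdiam _ _ v.2) hs).trans ?_
  simp

/-- The part of the graph of `x ↦ x̃ Ã` over the points `x` of `ℝ^d` for which every coordinate of
`v₀ x` lies within `δ` of the corresponding coordinate of `(v₁, …, v_d)`. -/
def affineGraphNear {d N : ℕ} (Atil : Matrix (Fin (d + 1)) (Fin (N - d)) ℝ) (δ : ℝ)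
    (v : Fin (d + 1) → ℤ) : Set (EuclideanSpace ℝ (Fin N)) :=
  {z | ∃ x : Fin d → ℝ,
    (∀ i : Fin N, (h : (i : ℕ) < d) → z i = x ⟨i, h⟩) ∧
    (∀ j : Fin (N - d), z ⟨d + (j : ℕ), by have := j.isLt; omega⟩ =
      Matrix.vecMul (Fin.cons 1 x) Atil j) ∧
    ∀ i, |v 0 * x i - v i.succ| ≤ δ}

/-- One plus the sum of the absolute values of the entries of a matrix. -/
noncomputable def entryBound {m n : ℕ} (B : Matrix (Fin m) (Fin n) ℝ) : ℝ :=
  1 + ∑ j, ∑ i, |B i j|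

theorem one_le_entryBound {m n : ℕ} (B : Matrix (Fin m) (Fin n) ℝ) : 1 ≤ entryBound B :=
  le_add_of_nonneg_right (by positivity)

theorem one_add_sum_abs_le_entryBound {d n : ℕ} (B : Matrix (Fin (d + 1)) (Fin n) ℝ) (j : Fin n) :
    1 + ∑ i : Fin d, |B i.succ j| ≤ entryBound B := by
  unfold entryBound
  gcongr
  refine le_trans ?_ (Finset.single_le_sum (f := fun j => ∑ i, |B i j|)
    (fun j _ => by positivity) (Finset.mem_univ j))
  rw [Fin.sum_univ_succ]
  exact le_add_of_nonneg_left (abs_nonneg _)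

theorem vecMul_cons_one {d n : ℕ} (B : Matrix (Fin (d + 1)) (Fin n) ℝ) (x : Fin d → ℝ)
    (j : Fin n) : Matrix.vecMul (Fin.cons 1 x) B j = B 0 j + ∑ i, x i * B i.succ j := by
  simp [Matrix.vecMul, dotProduct, Fin.sum_univ_succ]

theorem abs_sum_mul_le {n : ℕ} {y a : Fin n → ℝ} {ε : ℝ} (hy : ∀ i, |y i| ≤ ε) :
    |∑ i, y i * a i| ≤ ε * ∑ i, |a i| := by
  rw [Finset.mul_sum]
  refine (Finset.abs_sum_le_sum_abs _ _).trans (Finset.sum_le_sum fun i _ => ?_)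
  rw [abs_mul]
  exact mul_le_mul_of_nonneg_right (hy i) (abs_nonneg _)

theorem euclidean_dist_le_of_forall {N : ℕ} {z w : EuclideanSpace ℝ (Fin N)} {c : ℝ} (hc : 0 ≤ c)
    (h : ∀ i, |z i - w i| ≤ c) : dist z w ≤ N * c := by
  rw [EuclideanSpace.dist_eq]
  refine Real.sqrt_le_iff.mpr ⟨by positivity, ?_⟩
  calc ∑ i, dist (z i) (w i) ^ 2 ≤ ∑ _i : Fin N, c ^ 2 := by
        gcongr with i
        exact h i
    _ = N * c ^ 2 := by simp
    _ ≤ (N * c) ^ 2 := by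
        rw [mul_pow]
        gcongr
        exact_mod_cast Nat.le_self_pow two_ne_zero N

theorem ediam_affineGraphNear_le {d N : ℕ} (Atil : Matrix (Fin (d + 1)) (Fin (N - d)) ℝ)
    {δ Q : ℝ} (hδ : 0 ≤ δ) (hQ : 0 < Q) {v : Fin (d + 1) → ℤ} (hv : Q ≤ v 0) :
    Metric.ediam (affineGraphNear (N := N) Atil δ v) ≤
      ENNReal.ofReal (2 * N * entryBound Atil * (δ / Q)) := by
  have hM := one_le_entryBound Atil
  refine Metric.ediam_le ?_
  rintro z ⟨x, hx, hxA, hxv⟩ w ⟨y, hy, hyA, hyv⟩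
  have hv0 : (0 : ℝ) < v 0 := hQ.trans_le hv
  have hxy : ∀ i, |x i - y i| ≤ 2 * (δ / Q) := by
    intro i
    have h1 : |(v 0 : ℝ)| * |x i - y i| ≤ 2 * δ := by
      rw [← abs_mul, show (v 0 : ℝ) * (x i - y i) =
        (v 0 * x i - v i.succ) - (v 0 * y i - v i.succ) by ring]
      refine (abs_sub _ _).trans ?_
      linarith [hxv i, hyv i]
    rw [abs_of_pos hv0] at h1
    rw [← mul_div_assoc, le_div_iff₀ hQ]
    nlinarith [abs_nonneg (x i - y i)]
  have hε : 0 ≤ 2 * (δ / Q) := by positivity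
  rw [edist_dist]
  refine ENNReal.ofReal_le_ofReal ?_
  refine (euclidean_dist_le_of_forall (c := 2 * (δ / Q) * entryBound Atil) (by positivity)
    fun i => ?_).trans (le_of_eq (by ring))
  by_cases hi : (i : ℕ) < d
  · rw [hx i hi, hy i hi]
    exact (hxy _).trans (le_mul_of_one_le_right hε hM)
  · obtain ⟨j, hj⟩ : ∃ j : Fin (N - d), i = ⟨d + (j : ℕ), by have := j.isLt; omega⟩ :=
      ⟨⟨i - d, by have := i.isLt; omega⟩, by ext; simp; omega⟩
    rw [hj, hxA, hyA, vecMul_cons_one, vecMul_cons_one, add_sub_add_left_eq_sub,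
      ← Finset.sum_sub_distrib]
    simp only [← sub_mul]
    refine (abs_sum_mul_le hxy).trans (mul_le_mul_of_nonneg_left ?_ hε)
    linarith [one_add_sum_abs_le_entryBound Atil j]

open Classical in
/-- Integer vectors `(q, p)` with `2 ^ n ≤ q` in a box of size `2 ^ (n + 2)` whose image under
`Atil` is close to an integer point. -/
noncomputable def dyadicCandidates {d m : ℕ} (Atil : Matrix (Fin (d + 1)) (Fin m) ℝ) (ε : ℝ)
    (n : ℕ) : Finset (Fin (d + 1) → ℤ) :=
  {v ∈ Fintype.piFinset fun _ => Finset.Icc (-2 ^ (n + 2) : ℤ) (2 ^ (n + 2)) |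
    2 ^ n ≤ v 0 ∧ ∀ j, distNearestInt (∑ i, Atil i j * (v i : ℝ)) ≤ ε}

theorem mem_dyadicCandidates {d m : ℕ} {Atil : Matrix (Fin (d + 1)) (Fin m) ℝ} {ε : ℝ}
    {n : ℕ} {v : Fin (d + 1) → ℤ} :
    v ∈ dyadicCandidates Atil ε n ↔ (∀ i, |v i| ≤ 2 ^ (n + 2)) ∧ 2 ^ n ≤ v 0 ∧
      ∀ j, distNearestInt (∑ i, Atil i j * (v i : ℝ)) ≤ ε := by
  simp [dyadicCandidates, abs_le]

theorem exists_dyadicCandidate {d N n q : ℕ} {Atil : Matrix (Fin (d + 1)) (Fin (N - d)) ℝ} {δ : ℝ}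
    (hδ1 : δ ≤ 1) (hdN : d ≤ N) {z : EuclideanSpace ℝ (Fin N)} {x : Fin d → ℝ}
    (hx01 : ∀ i, x i ∈ Set.Icc (0 : ℝ) 1)
    (hx : ∀ i : Fin N, (h : (i : ℕ) < d) → z i = x ⟨i, h⟩)
    (hxA : ∀ j : Fin (N - d), z ⟨d + (j : ℕ), by have := j.isLt; omega⟩ =
      Matrix.vecMul (Fin.cons 1 x) Atil j)
    (hnq : 2 ^ n ≤ q) (hqn : q < 2 ^ (n + 1))
    (hz : ∀ i, distNearestInt ((q : ℝ) * z i) ≤ δ) :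
    ∃ v ∈ dyadicCandidates Atil (entryBound Atil * δ) n, z ∈ affineGraphNear Atil δ v := by
  let p : Fin d → ℤ := fun i => round ((q : ℝ) * x i)
  have hp : ∀ i, |(q : ℝ) * x i - p i| ≤ δ := by
    intro i
    have := hz ⟨i, i.isLt.trans_le hdN⟩
    rwa [hx _ i.isLt] at this
  refine ⟨Fin.cons (q : ℤ) p, mem_dyadicCandidates.mpr ⟨?_, ?_, ?_⟩, x, hx, hxA, ?_⟩
  · have hq2 : (q : ℤ) < 2 ^ (n + 1) := by exact_mod_cast hqn
    have hpow : (2 : ℤ) ^ (n + 2) = 2 * 2 ^ (n + 1) := by ring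
    have hone : (1 : ℤ) ≤ 2 ^ (n + 1) := one_le_pow₀ one_le_two
    intro i
    refine Fin.cases ?_ (fun i => ?_) i
    · rw [Fin.cons_zero, abs_of_nonneg (by positivity)]
      omega
    · rw [Fin.cons_succ]
      have h1 := abs_le.mp (hp i)
      have hq0 : (0 : ℝ) ≤ q := Nat.cast_nonneg q
      have hx0 : 0 ≤ (q : ℝ) * x i := mul_nonneg hq0 (hx01 i).1
      have hx1 : (q : ℝ) * x i ≤ q := mul_le_of_le_one_right hq0 (hx01 i).2
      have hlo : (-1 : ℝ) ≤ p i := by linarith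
      have hhi : (p i : ℝ) ≤ q + 1 := by linarith
      have hlo' : (-1 : ℤ) ≤ p i := by exact_mod_cast hlo
      have hhi' : p i ≤ q + 1 := by exact_mod_cast hhi
      rw [abs_le]
      omega
  · rw [Fin.cons_zero]
    exact_mod_cast hnq
  · intro j
    have hdec : ∑ i, Atil i j * ((Fin.cons (q : ℤ) p : Fin (d + 1) → ℤ) i : ℝ) =
        (q : ℝ) * Matrix.vecMul (Fin.cons 1 x) Atil j +
          ∑ i, (p i - (q : ℝ) * x i) * Atil i.succ j := by
      rw [vecMul_cons_one, Fin.sum_univ_succ]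
      simp only [Fin.cons_zero, Fin.cons_succ, mul_add, Finset.mul_sum, sub_mul,
        Finset.sum_sub_distrib, Int.cast_natCast, mul_assoc]
      simp only [mul_comm (Atil _ _)]
      ring
    rw [hdec]
    refine (distNearestInt_add_le _ _).trans ?_
    have h1 := hz ⟨d + (j : ℕ), by have := j.isLt; omega⟩
    rw [hxA] at h1
    have h2 := (distNearestInt_le_abs _).trans <|
      abs_sum_mul_le (a := fun i => Atil (Fin.succ i) j) (fun i => (abs_sub_comm _ _).trans_le (hp i))
    have hδ0 : 0 ≤ δ := (abs_nonneg _).trans h1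
    have h3 := mul_le_mul_of_nonneg_left (one_add_sum_abs_le_entryBound Atil j) hδ0
    linarith
  · intro i
    simpa using hp i

theorem summable_max_rpow_mul {f g w : ℕ → ℝ} {e : ℝ} (hf : ∀ q, 0 < f q) (hg : ∀ q, 0 < g q)
    (hw : ∀ q, 0 ≤ w q) (hfs : Summable fun q => f q ^ e * w q)
    (hgs : Summable fun q => g q ^ e * w q) :
    Summable fun q => max (f q) (g q) ^ e * w q := by
  refine Summable.of_nonneg_of_le (fun q => ?_) (fun q => ?_) (hfs.add hgs)
  · exact mul_nonneg (Real.rpow_nonneg ((hf q).le.trans (le_max_left _ _)) _) (hw q)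
  · have h1 := mul_nonneg (Real.rpow_nonneg (hf q).le e) (hw q)
    have h2 := mul_nonneg (Real.rpow_nonneg (hg q).le e) (hw q)
    rcases max_choice (f q) (g q) with h | h <;> rw [h] <;> linarith

theorem eventually_inv_pow_lt_log_pow {d : ℕ} (hd : 1 ≤ d) {c : ℝ} (hc : 0 < c) :
    ∀ᶠ n : ℕ in Filter.atTop, (1 / (6 * (d + 1) * 2 ^ (n + 2) : ℝ)) ^ (d + 1) <
      c * Real.log (2 ^ n) ^ d / ((2 : ℝ) ^ n) ^ (d + 1) := by
  have hlim : Filter.Tendsto (fun n : ℕ => c * ((n : ℝ) * Real.log 2) ^ d)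
      Filter.atTop Filter.atTop :=
    (((Filter.tendsto_pow_atTop (by omega)).comp
      (tendsto_natCast_atTop_atTop.atTop_mul_const (Real.log_pos one_lt_two)))).const_mul_atTop hc
  filter_upwards [hlim.eventually_gt_atTop 1] with n hn
  rw [Real.log_pow]
  have hd0 : (0 : ℝ) ≤ d := Nat.cast_nonneg d
  have h2n : (0 : ℝ) < 2 ^ n := by positivity
  calc (1 / (6 * (d + 1) * 2 ^ (n + 2) : ℝ)) ^ (d + 1) ≤ (1 / (2 : ℝ) ^ n) ^ (d + 1) := by
        gcongr
        rw [pow_add]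
        nlinarith
    _ = 1 / ((2 : ℝ) ^ n) ^ (d + 1) := one_div_pow _ _
    _ < _ := by gcongr

end

open MeasureTheory in
/-- **Proposition 1.14**: generalised Baker–Schmidt type zero-measure statement for the
subspace `ℋ`, under a `φ̃`-semi multiplicative badly approximable hypothesis on `Ã`. -/
theorem hausdorff_measure_zero_tilde (d N : ℕ) (hd : 1 ≤ d) (hdN : d < N) (s : ℝ) (hs : 0 ≤ s)
    (A : Matrix (Fin d) (Fin (N - d)) ℝ) (α₀ : Fin (N - d) → ℝ)
    (Atil : Matrix (Fin (d + 1)) (Fin (N - d)) ℝ)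
    (hAtil : Atil = Matrix.of (Fin.cons α₀ (fun i => A i)))
    (φt : ℝ → ℝ) (hφ01 : ∀ x, 1 ≤ x → 0 < φt x ∧ φt x ≤ 1)
    (hφmono : ∀ x y, 1 ≤ x → x ≤ y → φt y ≤ φt x)
    -- `Ã` is `φ̃`-semi multiplicatively badly approximable
    (hbad : ∀ q : Fin (N - d) → ℤ, q ≠ 0 →
      φt (intSupNorm q) ≤ intSupNorm q ^ (N - d) *
        ∏ i, distNearestInt (∑ j, Atil i j * (q j : ℝ)))
    -- (i)
    (hi : ∀ lam : ℝ, 1 ≤ lam → ∃ clam : ℝ, 0 < clam ∧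
      ∀ x : ℝ, 1 ≤ x → clam * φt x ≤ φt (lam * x))
    -- (ii)
    (hii : ∃ γ : ℝ, 0 < γ ∧ ∃ c₁ : ℝ, 0 < c₁ ∧ ∀ x : ℝ, 1 ≤ x → c₁ * x ^ (-γ) ≤ φt x)
    (hii' : ∃ c₂ : ℝ, 0 < c₂ ∧ ∀ x : ℝ, 1 < x → φt x ≤ c₂ / Real.log x)
    -- (iii)
    (hiii : ∃ ψhat : ℝ → ℝ, (∀ x, 1 ≤ x → 0 < ψhat x ∧ ψhat x ≤ 1) ∧
      (∀ x y, 1 ≤ x → x ≤ y → ψhat y ≤ ψhat x) ∧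
      Summable (fun q : ℕ =>
        ψhat ((q : ℝ) + 1) ^ ((N : ℝ) - d + s) * ((q : ℝ) + 1) ^ ((d : ℝ) - s)) ∧
      ∃ c₃ : ℝ, 0 < c₃ ∧ ∀ x : ℝ, 2 ≤ x →
        c₃ * Real.log x ^ d / x ^ (d + 1) ≤ φt (1 / ψhat x) * ψhat x ^ (N - d)) :
    ∀ ψ : ℝ → ℝ, (∀ x, 1 ≤ x → 0 < ψ x ∧ ψ x ≤ 1) →
      (∀ x y, 1 ≤ x → x ≤ y → ψ y ≤ ψ x) →
      Summable (fun q : ℕ =>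
        ψ ((q : ℝ) + 1) ^ ((N : ℝ) - d + s) * ((q : ℝ) + 1) ^ ((d : ℝ) - s)) →
      μH[s] (simultApprox N ψ ∩
        {z : EuclideanSpace ℝ (Fin N) | ∃ x : Fin d → ℝ,
          (∀ i, x i ∈ Set.Icc (0 : ℝ) 1) ∧
          (∀ i : Fin N, (h : (i : ℕ) < d) → z i = x ⟨i, h⟩) ∧
          (∀ j : Fin (N - d), z ⟨d + (j : ℕ), by have := j.isLt; omega⟩ =
            Matrix.vecMul (Fin.cons 1 x) Atil j)}) = 0 := by
  intro ψ hψ hψmono hψsum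
  obtain ⟨ψhat, hψhat, hψhatmono, hψhatsum, c₃, hc₃, hφψhat⟩ := hiii
  have hm : 0 < N - d := Nat.sub_pos_of_lt hdN
  have hcast : ((N - d : ℕ) : ℝ) = (N : ℝ) - d := Nat.cast_sub hdN.le
  have he : 0 ≤ (N : ℝ) - d + s := by rw [← hcast]; positivity
  set Ψ : ℝ → ℝ := fun x => max (ψ x) (ψhat x) with hΨ
  have hΨpos : ∀ x, 1 ≤ x → 0 < Ψ x := fun x hx => (hψ x hx).1.trans_le (le_max_left _ _)
  have hΨone : ∀ x, 1 ≤ x → Ψ x ≤ 1 := fun x hx => max_le (hψ x hx).2 (hψhat x hx).2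
  have hΨmono : ∀ x y, 1 ≤ x → x ≤ y → Ψ y ≤ Ψ x := fun x y hx hxy =>
    max_le_max (hψmono x y hx hxy) (hψhatmono x y hx hxy)
  have hone : ∀ q : ℕ, (1 : ℝ) ≤ (q : ℝ) + 1 := fun q => by simp
  have hΨsum := summable_condensed_mul_rpow he hΨpos hΨmono
    (summable_max_rpow_mul (fun q => (hψ _ (hone q)).1) (fun q => (hψhat _ (hone q)).1)
      (fun q => by positivity) hψsum hψhatsum)
  have hpow1 : ∀ n : ℕ, (1 : ℝ) ≤ 2 ^ n := fun n => one_le_pow₀ one_le_two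
  set M := entryBound Atil
  have hM : 1 ≤ M := one_le_entryBound Atil
  set δ : ℕ → ℝ := fun n => Ψ (2 ^ n) with hδ
  have hδ0 : ∀ n, 0 < δ n := fun n => hΨpos _ (hpow1 n)
  have hδ1 : ∀ n, δ n ≤ 1 := fun n => hΨone _ (hpow1 n)
  have hδanti : Antitone δ := fun n k hnk =>
    hΨmono _ _ (hpow1 n) (pow_le_pow_right₀ one_le_two hnk)
  set C : ℝ := 4 * (12 * (N - d : ℕ) * M) ^ (N - d) * (6 * (d + 1) * 4) ^ (d + 1) *
    (2 * N * M) ^ s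
  have hcard : ∀ᶠ n in Filter.atTop, ((dyadicCandidates Atil (M * δ n) n).card : ℝ) ≤
      4 * (12 * (N - d : ℕ) * M * δ n) ^ (N - d) * (6 * (d + 1) * 2 ^ (n + 2)) ^ (d + 1) := by
    filter_upwards [eventually_inv_pow_lt_log_pow hd hc₃, Filter.eventually_ge_atTop 1]
      with n hn hn1
    refine card_le_of_semi_mult_bad hm Atil hφmono hbad hM (hδ0 n) (hpow1 _) (hn.trans_le ?_) _
      (fun v hv i => by exact_mod_cast (mem_dyadicCandidates.mp hv).1 i)
      (fun v hv => (mem_dyadicCandidates.mp hv).2.2)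
    refine (hφψhat _ (le_self_pow₀ one_le_two (by omega))).trans ?_
    have hhat0 := (hψhat _ (hpow1 n)).1
    have hle : ψhat (2 ^ n) ≤ δ n := le_max_right _ _
    have hinv : 1 ≤ 1 / δ n := (one_le_div (hδ0 n)).mpr (hδ1 n)
    refine mul_le_mul (hφmono _ _ hinv (one_div_le_one_div_of_le hhat0 hle))
      (pow_le_pow_left₀ hhat0.le hle _) (by positivity) (hφ01 _ hinv).1.le
  have hρanti : Antitone fun n => ENNReal.ofReal (2 * N * M * (δ n / 2 ^ n)) := by
    intro n k hnk
    refine ENNReal.ofReal_le_ofReal (mul_le_mul_of_nonneg_left ?_ (by positivity))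
    exact div_le_div₀ (hδ0 n).le (hδanti hnk) (by positivity) (pow_le_pow_right₀ one_le_two hnk)
  have hρlim : Filter.Tendsto (fun n => ENNReal.ofReal (2 * N * M * (δ n / 2 ^ n)))
      Filter.atTop (nhds 0) := by
    rw [← ENNReal.ofReal_zero, ← mul_zero (2 * (N : ℝ) * M)]
    refine ENNReal.tendsto_ofReal (Filter.Tendsto.const_mul _ ?_)
    refine squeeze_zero (fun n => by have := hδ0 n; positivity)
      (fun n => div_le_div_of_nonneg_right (hδ1 n) (by positivity)) ?_
    simpa using tendsto_pow_atTop_nhds_zero_of_lt_one (r := (1 / 2 : ℝ)) (by norm_num) (by norm_num)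
  refine hausdorffMeasure_eq_zero_of_covers hs (fun n => dyadicCandidates Atil (M * δ n) n)
    (fun n v => affineGraphNear Atil (δ n) v) hρanti hρlim
    (b := fun n => ENNReal.ofReal (C * (δ n ^ ((N : ℝ) - d + s) *
      ((2 : ℝ) ^ n) ^ ((d : ℝ) - s + 1)))) (fun n v hv => ?_) ?_ ?_ ?_
  · refine ediam_affineGraphNear_le Atil (hδ0 n).le (by positivity) ?_
    exact_mod_cast (mem_dyadicCandidates.mp hv).2.1
  · exact (hΨsum.mul_left C).tsum_ofReal_ne_top
  · filter_upwards [hcard] with n hn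
    have hδn := hδ0 n
    have hP : (0 : ℝ) < 2 ^ n := by positivity
    rw [ENNReal.ofReal_rpow_of_nonneg (by positivity) hs, ← ENNReal.ofReal_natCast,
      ← ENNReal.ofReal_mul (Nat.cast_nonneg _)]
    refine ENNReal.ofReal_le_ofReal ((mul_le_mul_of_nonneg_right hn (by positivity)).trans_eq ?_)
    rw [Real.mul_rpow (by positivity) (by positivity), Real.div_rpow hδn.le hP.le,
      Real.rpow_add hδn, ← hcast, Real.rpow_natCast,
      show (d : ℝ) - s + 1 = ((d + 1 : ℕ) : ℝ) - s by push_cast; ring,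
      Real.rpow_sub hP, Real.rpow_natCast, mul_pow _ (δ n), pow_add 2 n 2,
      show 6 * ((d : ℝ) + 1) * (2 ^ n * 2 ^ 2) = 6 * (d + 1) * 4 * 2 ^ n by ring,
      mul_pow _ ((2 : ℝ) ^ n)]
    simp only [C]
    ring
  · rintro n₀ z ⟨hz, x, hx01, hx, hxA⟩
    obtain ⟨q, ⟨hq0, hq⟩, hqn₀⟩ := hz.exists_gt (2 ^ n₀)
    have hlog : 2 ^ Nat.log 2 q ≤ q := Nat.pow_log_le_self 2 hq0.ne'
    have hψle : ψ q ≤ δ (Nat.log 2 q) :=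
      (hψmono _ _ (hpow1 _) (by exact_mod_cast hlog)).trans (le_max_left _ _)
    obtain ⟨v, hv, hzv⟩ := exists_dyadicCandidate (hδ1 _) hdN.le hx01 hx hxA hlog
      (Nat.lt_pow_succ_log_self one_lt_two q) fun i => (hq i).le.trans hψle
    simp only [Set.mem_iUnion]
    exact ⟨_, Nat.le_log_of_pow_le one_lt_two hqn₀.le, v, hv, hzv⟩
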